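/- Let K be a compact Hausdorff space and let t, s ∈ K with t ≠ s. The measure δ_t − δ_s is a weak* strongly exposed point of the unit ball B₀ = { μ : max{μ⁺(K), μ⁻(K)} ≤ 1 } — meaning there exists x ∈ C(K) with ‖x‖_d = 1 and x(t) − x(s) = 1 such that every sequence (μ_n) in B₀ with ∫_K x dμ_n → 1 converges to δ_t − δ_s in the total variation norm — if and only if both t and s are isolated points of K. -/

import Mathlib

open MeasureTheory Filter Topology

namespace MeasureTheory

section Dirac

variable {α : Type*} [MeasurableSpace α] [MeasurableSingletonClass α]

theorem Measure.innerRegular_dirac [TopologicalSpace α] (a : α) :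
    (Measure.dirac a).InnerRegular where
  innerRegular := by
    intro U hU r hr
    by_cases ha : a ∈ U
    · refine ⟨{a}, Set.singleton_subset_iff.2 ha, isCompact_singleton, ?_⟩
      simpa [ha] using hr
    · simp [ha] at hr

theorem Measure.mutuallySingular_dirac_dirac {a b : α} (hab : a ≠ b) :
    (Measure.dirac a).MutuallySingular (Measure.dirac b) :=
  ⟨{b}, measurableSet_singleton b, by simp [hab], by simp⟩

theorem SignedMeasure.toJordanDecomposition_dirac_sub_dirac {a b : α} (hab : a ≠ b) :
    ((Measure.dirac a).toSignedMeasure - (Measure.dirac b).toSignedMeasure).toJordanDecomposition =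
      { posPart := Measure.dirac a
        negPart := Measure.dirac b
        mutuallySingular := Measure.mutuallySingular_dirac_dirac hab } :=
  SignedMeasure.toJordanDecomposition_eq rfl

theorem Measure.abs_real_sub_dirac_le (μ : Measure α) [IsFiniteMeasure μ]
    (hμ : μ.real Set.univ ≤ 1) (a : α) {A : Set α} (hA : MeasurableSet A) :
    |μ.real A - (Measure.dirac a).real A| ≤ 1 - μ.real {a} := by
  by_cases ha : a ∈ A
  · have h₁ : μ.real {a} ≤ μ.real A := measureReal_mono (Set.singleton_subset_iff.2 ha)
    have h₂ : μ.real A ≤ μ.real Set.univ := measureReal_mono (Set.subset_univ A)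
    have h₃ : (Measure.dirac a).real A = 1 := by simp [measureReal_def, ha]
    rw [h₃, abs_le]
    constructor <;> linarith
  · have h₁ : μ.real {a} ≤ μ.real Aᶜ := measureReal_mono (Set.singleton_subset_iff.2 ha)
    have h₂ := measureReal_add_measureReal_compl (μ := μ) hA
    have h₃ : (Measure.dirac a).real A = 0 := by simp [measureReal_def, ha]
    have h₄ : 0 ≤ μ.real A := measureReal_nonneg
    rw [h₃, abs_le]
    constructor <;> linarith

end Dirac

namespace SignedMeasure

variable {α : Type*} [MeasurableSpace α]

theorem abs_apply_le_totalVariation_univ (ν : SignedMeasure α) {A : Set α}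
    (hA : MeasurableSet A) : |ν A| ≤ (ν.totalVariation Set.univ).toReal := by
  have h₁ := ν.apply_eq_posPart_real_sub_negPart_real hA
  have h₂ : (ν.totalVariation Set.univ).toReal =
      ν.toJordanDecomposition.posPart.real Set.univ +
        ν.toJordanDecomposition.negPart.real Set.univ :=
    measureReal_add_apply
  have h₃ : ν.toJordanDecomposition.posPart.real A ≤
    ν.toJordanDecomposition.posPart.real Set.univ := measureReal_mono (Set.subset_univ A)
  have h₄ : ν.toJordanDecomposition.negPart.real A ≤
    ν.toJordanDecomposition.negPart.real Set.univ := measureReal_mono (Set.subset_univ A)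
  have h₅ : 0 ≤ ν.toJordanDecomposition.posPart.real A := measureReal_nonneg
  have h₆ : 0 ≤ ν.toJordanDecomposition.negPart.real A := measureReal_nonneg
  rw [h₁, h₂, abs_le]
  constructor <;> linarith

theorem totalVariation_univ_le_two_mul (ν : SignedMeasure α) {c : ℝ}
    (hc : ∀ A, MeasurableSet A → |ν A| ≤ c) :
    (ν.totalVariation Set.univ).toReal ≤ 2 * c := by
  obtain ⟨S, hS, -, -, hpos, hneg⟩ := ν.toJordanDecomposition.exists_compl_positive_negative
  have h₁ : (ν.totalVariation Set.univ).toReal =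
      ν.toJordanDecomposition.posPart.real Set.univ +
        ν.toJordanDecomposition.negPart.real Set.univ :=
    measureReal_add_apply
  have h₂ := measureReal_add_measureReal_compl (μ := ν.toJordanDecomposition.posPart) hS
  have h₃ := measureReal_add_measureReal_compl (μ := ν.toJordanDecomposition.negPart) hS
  have h₄ := ν.apply_eq_posPart_real_sub_negPart_real hS
  have h₅ := ν.apply_eq_posPart_real_sub_negPart_real hS.compl
  have h₆ : ν.toJordanDecomposition.posPart.real S = 0 := by simp [measureReal_def, hpos]
  have h₇ : ν.toJordanDecomposition.negPart.real Sᶜ = 0 := by simp [measureReal_def, hneg]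
  have h₈ := neg_abs_le (ν S)
  have h₉ := le_abs_self (ν Sᶜ)
  linarith [hc S hS, hc Sᶜ hS.compl]

theorem totalVariation_sub_dirac_sub_dirac_le [MeasurableSingletonClass α] (μ : SignedMeasure α)
    (hpos : μ.toJordanDecomposition.posPart.real Set.univ ≤ 1)
    (hneg : μ.toJordanDecomposition.negPart.real Set.univ ≤ 1) (a b : α) :
    ((μ - ((Measure.dirac a).toSignedMeasure
        - (Measure.dirac b).toSignedMeasure)).totalVariation Set.univ).toReal ≤
      2 * ((1 - μ.toJordanDecomposition.posPart.real {a}) +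
        (1 - μ.toJordanDecomposition.negPart.real {b})) := by
  refine totalVariation_univ_le_two_mul _ fun A hA => ?_
  have h₁ := μ.toJordanDecomposition.posPart.abs_real_sub_dirac_le hpos a hA
  have h₂ := μ.toJordanDecomposition.negPart.abs_real_sub_dirac_le hneg b hA
  have h₃ := μ.apply_eq_posPart_real_sub_negPart_real hA
  rw [_root_.sub_apply, Measure.toSignedMeasure_sub_apply hA, h₃]
  rw [abs_le] at *
  constructor <;> linarith [h₁.1, h₁.2, h₂.1, h₂.2]

end SignedMeasure

end MeasureTheory

section Exposed

variable {K : Type*} [TopologicalSpace K] [MeasurableSpace K]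

/-- `x` exposes `δ_t - δ_s` strongly in the unit ball of the regular Borel signed measures
normed by `max {μ⁺(K), μ⁻(K)}`. -/
def StronglyExposesDiracSubDirac (x : C(K, ℝ)) (t s : K) : Prop :=
  ∀ μs : ℕ → SignedMeasure K,
    (∀ n, (μs n).totalVariation.Regular ∧
      max ((μs n).toJordanDecomposition.posPart Set.univ).toReal
          ((μs n).toJordanDecomposition.negPart Set.univ).toReal ≤ 1) →
    Tendsto (fun n =>
        (∫ u, x u ∂(μs n).toJordanDecomposition.posPart)
          - ∫ u, x u ∂(μs n).toJordanDecomposition.negPart)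
      atTop (𝓝 1) →
    Tendsto (fun n =>
        ((μs n - ((Measure.dirac t).toSignedMeasure
            - (Measure.dirac s).toSignedMeasure)).totalVariation Set.univ).toReal)
      atTop (𝓝 0)

theorem StronglyExposesDiracSubDirac.tendsto_apply [CompactSpace K] [T2Space K] [BorelSpace K]
    {x : C(K, ℝ)} {t s : K} (hx : StronglyExposesDiracSubDirac x t s) {p q : ℕ → K}
    (hpq : ∀ n, p n ≠ q n) (hlim : Tendsto (fun n => x (p n) - x (q n)) atTop (𝓝 1))
    {A : Set K} (hA : MeasurableSet A) :
    Tendsto (fun n => ((Measure.dirac (p n)).real A - (Measure.dirac (q n)).real A)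
      - ((Measure.dirac t).real A - (Measure.dirac s).real A)) atTop (𝓝 0) := by
  have h := hx (fun n => (Measure.dirac (p n)).toSignedMeasure
    - (Measure.dirac (q n)).toSignedMeasure) (fun n => ?_) ?_
  · refine squeeze_zero_norm (fun n => ?_) h
    have h₁ := SignedMeasure.abs_apply_le_totalVariation_univ
      ((Measure.dirac (p n)).toSignedMeasure - (Measure.dirac (q n)).toSignedMeasure
        - ((Measure.dirac t).toSignedMeasure - (Measure.dirac s).toSignedMeasure)) hA
    rwa [_root_.sub_apply, Measure.toSignedMeasure_sub_apply hA,
      Measure.toSignedMeasure_sub_apply hA] at h₁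
  · rw [SignedMeasure.totalVariation,
      SignedMeasure.toJordanDecomposition_dirac_sub_dirac (hpq n)]
    have := Measure.innerRegular_dirac (p n)
    have := Measure.innerRegular_dirac (q n)
    exact ⟨inferInstance, by simp⟩
  · refine hlim.congr fun n => ?_
    simp only [SignedMeasure.toJordanDecomposition_dirac_sub_dirac (hpq n)]
    rw [integral_dirac, integral_dirac]

theorem exists_seq_tendsto_of_not_isOpen_singleton {X : Type*} [TopologicalSpace X] [T1Space X]
    (x : C(X, ℝ)) {a : X} (ha : ¬ IsOpen ({a} : Set X)) (b : X) :
    ∃ u : ℕ → X, (∀ n, u n ≠ a ∧ u n ≠ b) ∧ Tendsto (fun n => x (u n)) atTop (𝓝 (x a)) := by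
  have : (𝓝[≠] a).NeBot := ⟨fun h => ha ((isOpen_singleton_iff_punctured_nhds a).2 h)⟩
  have hb : ∀ᶠ y in 𝓝[≠] a, y ≠ b := by
    rcases eq_or_ne a b with rfl | hab
    · exact eventually_mem_nhdsWithin
    · exact eventually_nhdsWithin_of_eventually_nhds (isOpen_ne.eventually_mem hab)
  have hdist : ∀ n : ℕ, ∀ᶠ y in 𝓝[≠] a, dist (x y) (x a) < 1 / ((n : ℝ) + 1) := fun n =>
    eventually_nhdsWithin_of_eventually_nhds
      (x.continuous.continuousAt.eventually (Metric.ball_mem_nhds _ Nat.one_div_pos_of_nat))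
  have hex : ∀ n : ℕ, ∃ y, (y ≠ a ∧ y ≠ b) ∧ dist (x y) (x a) < 1 / ((n : ℝ) + 1) := fun n =>
    ((eventually_mem_nhdsWithin.and hb).and (hdist n)).exists
  choose u hu hux using hex
  refine ⟨u, hu, tendsto_iff_dist_tendsto_zero.2 ?_⟩
  exact squeeze_zero (fun _ => dist_nonneg) (fun n => (hux n).le)
    tendsto_one_div_add_atTop_nhds_zero_nat

theorem StronglyExposesDiracSubDirac.isOpen_singletons [CompactSpace K] [T2Space K] [BorelSpace K]
    {x : C(K, ℝ)} {t s : K} (hts : t ≠ s) (hx : StronglyExposesDiracSubDirac x t s)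
    (hxts : x t - x s = 1) : IsOpen ({t} : Set K) ∧ IsOpen ({s} : Set K) := by
  constructor
  · by_contra ht
    obtain ⟨u, hu, hlim⟩ := exists_seq_tendsto_of_not_isOpen_singleton x ht s
    have h := hx.tendsto_apply (p := u) (q := fun _ => s) (fun n => (hu n).2)
      (hxts ▸ hlim.sub_const (x s)) (measurableSet_singleton t)
    simp [measureReal_def, fun n => (hu n).1, hts.symm] at h
  · by_contra hs
    obtain ⟨u, hu, hlim⟩ := exists_seq_tendsto_of_not_isOpen_singleton x hs t
    have h := hx.tendsto_apply (p := fun _ => t) (q := u) (fun n => (hu n).2.symm)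
      (hxts ▸ hlim.const_sub (x t)) (measurableSet_singleton s)
    simp [measureReal_def, fun n => (hu n).1, hts] at h

/-- Half the difference of the indicator functions of two isolated points. -/
noncomputable def halfIndicatorSub {X : Type*} [TopologicalSpace X] [T1Space X] {t s : X}
    (ht : IsOpen ({t} : Set X)) (hs : IsOpen ({s} : Set X)) : C(X, ℝ) where
  toFun u := Set.indicator {t} (fun _ => (1 / 2 : ℝ)) u -
    Set.indicator {s} (fun _ => (1 / 2 : ℝ)) u
  continuous_toFun :=
    (IsClopen.continuous_indicator ⟨isClosed_singleton, ht⟩ continuous_const).sub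
      (IsClopen.continuous_indicator ⟨isClosed_singleton, hs⟩ continuous_const)

theorem norm_halfIndicatorSub_sup_zero {X : Type*} [TopologicalSpace X] [CompactSpace X]
    [T1Space X] {t s : X} (hts : t ≠ s) (ht : IsOpen ({t} : Set X)) (hs : IsOpen ({s} : Set X)) :
    ‖halfIndicatorSub ht hs ⊔ 0‖ = 1 / 2 := by
  apply le_antisymm
  · refine (ContinuousMap.norm_le _ (by norm_num)).2 fun u => ?_
    by_cases h₁ : u = t <;> by_cases h₂ : u = s <;>
      simp [halfIndicatorSub, h₁, h₂, hts, hts.symm]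
  · have h := ContinuousMap.norm_coe_le_norm (halfIndicatorSub ht hs ⊔ 0) t
    simpa [halfIndicatorSub, hts] using h

theorem neg_halfIndicatorSub {X : Type*} [TopologicalSpace X] [T1Space X] {t s : X}
    (ht : IsOpen ({t} : Set X)) (hs : IsOpen ({s} : Set X)) :
    -halfIndicatorSub ht hs = halfIndicatorSub hs ht := by
  ext u
  simp [halfIndicatorSub]

theorem integral_halfIndicatorSub [T1Space K] [MeasurableSingletonClass K] {t s : K}
    (ht : IsOpen ({t} : Set K)) (hs : IsOpen ({s} : Set K)) (μ : Measure K) [IsFiniteMeasure μ] :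
    ∫ u, halfIndicatorSub ht hs u ∂μ = (μ.real {t} - μ.real {s}) / 2 := by
  simp only [halfIndicatorSub, ContinuousMap.coe_mk]
  rw [integral_sub ((integrable_const _).indicator (measurableSet_singleton t))
    ((integrable_const _).indicator (measurableSet_singleton s)),
    integral_indicator_const _ (measurableSet_singleton t),
    integral_indicator_const _ (measurableSet_singleton s)]
  simp only [smul_eq_mul]
  ring

theorem stronglyExposesDiracSubDirac_halfIndicatorSub [T1Space K] [MeasurableSingletonClass K]
    {t s : K} (ht : IsOpen ({t} : Set K)) (hs : IsOpen ({s} : Set K)) :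
    StronglyExposesDiracSubDirac (halfIndicatorSub ht hs) t s := by
  intro μs hμs hlim
  have hzero := (hlim.const_sub 1).const_mul 4
  rw [sub_self, mul_zero] at hzero
  refine squeeze_zero (fun _ => ENNReal.toReal_nonneg) (fun n => ?_) hzero
  have h₁ := SignedMeasure.totalVariation_sub_dirac_sub_dirac_le (μs n)
    ((le_max_left _ _).trans (hμs n).2) ((le_max_right _ _).trans (hμs n).2) t s
  rw [integral_halfIndicatorSub, integral_halfIndicatorSub]
  have h₂ : 0 ≤ (μs n).toJordanDecomposition.posPart.real {s} := measureReal_nonneg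
  have h₃ : 0 ≤ (μs n).toJordanDecomposition.negPart.real {t} := measureReal_nonneg
  linarith

end Exposed

/-- For distinct points `t, s` of a compact Hausdorff space `K`, the measure
`δ_t - δ_s` is a weak* strongly exposed point of the unit ball
`B₀ = {μ regular : max {μ⁺(K), μ⁻(K)} ≤ 1}` of the regular Borel signed measures
if and only if both `t` and `s` are isolated points of `K`. -/
theorem dirac_sub_dirac_weak_star_strongly_exposed_iff_isolated
    {K : Type*} [TopologicalSpace K] [CompactSpace K] [T2Space K]
    [MeasurableSpace K] [BorelSpace K] (t s : K) (hts : t ≠ s) :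
    (∃ x : C(K, ℝ), ‖x ⊔ 0‖ + ‖(-x) ⊔ 0‖ = 1 ∧ x t - x s = 1 ∧
        ∀ μs : ℕ → SignedMeasure K,
          (∀ n, (μs n).totalVariation.Regular ∧
            max ((μs n).toJordanDecomposition.posPart Set.univ).toReal
                ((μs n).toJordanDecomposition.negPart Set.univ).toReal ≤ 1) →
          Tendsto (fun n =>
              (∫ u, x u ∂(μs n).toJordanDecomposition.posPart)
                - ∫ u, x u ∂(μs n).toJordanDecomposition.negPart)
            atTop (𝓝 1) →
          Tendsto (fun n =>
              ((μs n - ((Measure.dirac t).toSignedMeasure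
                  - (Measure.dirac s).toSignedMeasure)).totalVariation Set.univ).toReal)
            atTop (𝓝 0)) ↔
      (IsOpen ({t} : Set K) ∧ IsOpen ({s} : Set K)) := by
  constructor
  · rintro ⟨x, -, hxts, hx⟩
    exact StronglyExposesDiracSubDirac.isOpen_singletons hts hx hxts
  · rintro ⟨ht, hs⟩
    refine ⟨halfIndicatorSub ht hs, ?_, ?_, stronglyExposesDiracSubDirac_halfIndicatorSub ht hs⟩
    · rw [neg_halfIndicatorSub, norm_halfIndicatorSub_sup_zero hts,
        norm_halfIndicatorSub_sup_zero hts.symm]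
      norm_num
    · simp [halfIndicatorSub, hts, hts.symm]
      norm_num
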